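/- The Rollnik norm of the Yukawa potential is at most $\frac{4\pi^{5/3}}{3}$, which is strictly less than $4\pi$; i.e. $\int_{\mathbb{R}^3 \times \mathbb{R}^3} \frac{e^{-|x|}\, e^{-|y|}}{|x|\,|y|\,|x-y|^2}\, d(x,y) \le \frac{16\pi^{10/3}}{9} < 16\pi^2$. -/

import Mathlib

open MeasureTheory Real

theorem lintegral_exp_neg_mul_Ioi {a : ℝ} (ha : 0 < a) (c : ℝ) :
    ∫⁻ t in Set.Ioi c, ENNReal.ofReal (exp (-a * t)) = ENNReal.ofReal (exp (-a * c) / a) := by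
  have ha' : -a < 0 := neg_lt_zero.mpr ha
  rw [← ofReal_integral_eq_lintegral_ofReal (integrableOn_exp_mul_Ioi ha' c)
    (ae_of_all _ fun t => (exp_pos _).le), integral_exp_mul_Ioi ha' c, neg_div_neg_eq]

theorem lintegral_gaussian_real : ∫⁻ x : ℝ, ENNReal.ofReal (exp (-x ^ 2)) = ENNReal.ofReal √π := by
  have h := integrable_exp_neg_mul_sq (b := 1) one_pos
  have h' := integral_gaussian 1
  simp only [neg_mul, one_mul, div_one] at h h'
  rw [← ofReal_integral_eq_lintegral_ofReal h (ae_of_all _ fun t => (exp_pos _).le), h']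

/-- Cauchy–Schlömilch evaluation of a Bessel-type integral. -/
theorem lintegral_exp_neg_sq_sub_inv_sq {r : ℝ} (hr : 0 < r) :
    ∫⁻ v in Set.Ioi (0 : ℝ), ENNReal.ofReal (exp (-(v ^ 2 * r ^ 2)) * exp (-1 / (4 * v ^ 2)))
      = ENNReal.ofReal (√π / 2 * (exp (-r) / r)) := by
  set φ : ℝ → ℝ := fun v => r * v - 1 / (2 * v) with hφ
  set g : ℝ → ENNReal := fun x => ENNReal.ofReal (exp (-x ^ 2)) with hg
  have hgm : Measurable fun v => g (φ v) := by simp only [hg, hφ]; fun_prop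
  have hφmono : StrictMonoOn φ (Set.Ioi 0) := by
    intro v hv w hw hvw
    have h1 : 1 / (2 * w) < 1 / (2 * v) := by
      have : (0:ℝ) < v := hv
      gcongr
    have h2 : r * v < r * w := by gcongr
    simp only [hφ]; linarith
  have hφimg : φ '' Set.Ioi 0 = Set.univ := by
    refine Set.eq_univ_of_forall fun x => ?_
    have hs : √(x ^ 2 + 2 * r) ^ 2 = x ^ 2 + 2 * r := sq_sqrt (by positivity)
    have hlt : |x| < √(x ^ 2 + 2 * r) := by
      rw [← sqrt_sq_eq_abs]; exact sqrt_lt_sqrt (sq_nonneg x) (by linarith)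
    have hpos : 0 < x + √(x ^ 2 + 2 * r) := by linarith [neg_abs_le x]
    refine ⟨(x + √(x ^ 2 + 2 * r)) / (2 * r), div_pos hpos (by positivity), ?_⟩
    generalize √(x ^ 2 + 2 * r) = s at *
    simp only [hφ]
    field_simp
    linear_combination hs
  have hφd : ∀ v ∈ Set.Ioi (0 : ℝ),
      HasDerivWithinAt φ (r + 1 / (2 * v ^ 2)) (Set.Ioi 0) v := by
    intro v hv
    have hv0 : v ≠ 0 := ne_of_gt hv
    have h := ((hasDerivAt_id v).const_mul r).sub
      (((hasDerivAt_id v).const_mul 2).fun_inv (by simpa using hv0))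
    refine (h.congr_deriv ?_).hasDerivWithinAt.congr (fun y _ => ?_) ?_
    · simp; field_simp; ring
    · simp [hφ]
    · simp [hφ]
  have hwhole := lintegral_image_eq_lintegral_abs_deriv_mul measurableSet_Ioi hφd hφmono.injOn g
  rw [hφimg, Measure.restrict_univ, lintegral_gaussian_real] at hwhole
  have hminj : Set.InjOn (fun v : ℝ => 1 / (2 * r * v)) (Set.Ioi 0) := by
    intro v hv w hw h
    simpa [hr.ne'] using h
  have hmimg : (fun v : ℝ => 1 / (2 * r * v)) '' Set.Ioi 0 = Set.Ioi 0 := by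
    ext x
    constructor
    · rintro ⟨v, hv, rfl⟩
      have : (0:ℝ) < v := hv
      simp only [Set.mem_Ioi]; positivity
    · intro hx
      have : (0:ℝ) < x := hx
      exact ⟨1 / (2 * r * x), by simp only [Set.mem_Ioi]; positivity, by field_simp⟩
  have hmd : ∀ v ∈ Set.Ioi (0 : ℝ), HasDerivWithinAt (fun v : ℝ => 1 / (2 * r * v))
      (-(1 / (2 * r * v ^ 2))) (Set.Ioi 0) v := by
    intro v hv
    have hv0 : v ≠ 0 := ne_of_gt hv
    have h := ((hasDerivAt_id v).const_mul (2 * r)).fun_inv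
      (by simpa using ⟨hr.ne', hv0⟩)
    refine (h.congr_deriv ?_).hasDerivWithinAt.congr (fun y _ => ?_) ?_
    · simp; field_simp
    · simp
    · simp
  have hrefl := lintegral_image_eq_lintegral_abs_deriv_mul measurableSet_Ioi hmd hminj
    (fun v => g (φ v))
  rw [hmimg] at hrefl
  have hsum : ENNReal.ofReal √π
      = ENNReal.ofReal (2 * r) * ∫⁻ v in Set.Ioi (0 : ℝ), g (φ v) := by
    have hr2 : ENNReal.ofReal (2 * r) = ENNReal.ofReal r + ENNReal.ofReal r := by
      rw [two_mul, ENNReal.ofReal_add hr.le hr.le]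
    rw [hr2, add_mul]
    nth_rw 2 [hrefl]
    rw [← lintegral_const_mul _ hgm, ← lintegral_const_mul' _ _ ENNReal.ofReal_ne_top,
      ← lintegral_add_left (hgm.const_mul _), hwhole]
    refine setLIntegral_congr_fun measurableSet_Ioi fun v hv => ?_
    have hv' : (0:ℝ) < v := hv
    have h1 : φ (1 / (2 * r * v)) = -φ v := by simp only [hφ]; field_simp; ring
    have h2 : g (φ (1 / (2 * r * v))) = g (φ v) := by simp only [hg, h1, neg_sq]
    simp only [h2]
    rw [← mul_assoc, ← add_mul, abs_neg, abs_of_pos (by positivity), abs_of_pos (by positivity),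
      ← ENNReal.ofReal_mul hr.le, ← ENNReal.ofReal_add hr.le (by positivity)]
    congr 3
    field_simp
  have hJ : ∫⁻ v in Set.Ioi (0 : ℝ), g (φ v) = ENNReal.ofReal (√π / (2 * r)) := by
    rw [ENNReal.ofReal_div_of_pos (by positivity), hsum, mul_comm,
      ENNReal.mul_div_cancel_right (by simpa using hr) ENNReal.ofReal_ne_top]
  have hfact : ∫⁻ v in Set.Ioi (0 : ℝ),
      ENNReal.ofReal (exp (-(v ^ 2 * r ^ 2)) * exp (-1 / (4 * v ^ 2)))
      = ∫⁻ v in Set.Ioi (0 : ℝ), ENNReal.ofReal (exp (-r)) * g (φ v) := by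
    refine setLIntegral_congr_fun measurableSet_Ioi fun v hv => ?_
    have hv' : (0:ℝ) < v := hv
    simp only [hg, hφ]
    rw [← ENNReal.ofReal_mul (exp_pos _).le, ← exp_add, ← exp_add]
    congr 2
    field_simp
    ring
  rw [hfact, lintegral_const_mul _ hgm, hJ, ← ENNReal.ofReal_mul (exp_pos _).le]
  congr 1
  field_simp

theorem lintegral_exp_neg_inv_sq_div_cube {a : ℝ} (ha : 0 < a) :
    ∫⁻ v in Set.Ioi (0 : ℝ), ENNReal.ofReal (exp (-a / (4 * v ^ 2)) / (2 * v ^ 3))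
      = ENNReal.ofReal (1 / a) := by
  have hinj : Set.InjOn (fun v : ℝ => 1 / (4 * v ^ 2)) (Set.Ioi 0) := by
    intro v hv w hw h
    have : v ^ 2 = w ^ 2 := by simpa using h
    have hv' : 0 < v := hv
    have hw' : 0 < w := hw
    exact (pow_left_inj₀ hv'.le hw'.le two_ne_zero).mp this
  have himg : (fun v : ℝ => 1 / (4 * v ^ 2)) '' Set.Ioi 0 = Set.Ioi 0 := by
    ext x
    constructor
    · rintro ⟨v, hv, rfl⟩
      have : (0:ℝ) < v := hv
      simp only [Set.mem_Ioi]; positivity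
    · intro hx
      have hx' : (0:ℝ) < x := hx
      refine ⟨1 / (2 * √x), by simp only [Set.mem_Ioi]; positivity, ?_⟩
      simp only [div_pow, mul_pow, sq_sqrt hx'.le]
      field_simp
      norm_num
  have hd : ∀ v ∈ Set.Ioi (0 : ℝ), HasDerivWithinAt (fun v : ℝ => 1 / (4 * v ^ 2))
      (-(1 / (2 * v ^ 3))) (Set.Ioi 0) v := by
    intro v hv
    have hv0 : v ≠ 0 := ne_of_gt hv
    have h := ((hasDerivAt_pow 2 v).const_mul 4).fun_inv (by simpa using hv0)
    refine (h.congr_deriv ?_).hasDerivWithinAt.congr (fun y _ => ?_) ?_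
    · simp; field_simp; norm_num
    · simp
    · simp
  have h := lintegral_image_eq_lintegral_abs_deriv_mul measurableSet_Ioi hd hinj
    (fun t => ENNReal.ofReal (exp (-a * t)))
  rw [himg, lintegral_exp_neg_mul_Ioi ha, mul_zero, exp_zero] at h
  rw [h]
  refine setLIntegral_congr_fun measurableSet_Ioi fun v hv => ?_
  have hv' : (0:ℝ) < v := hv
  rw [abs_neg, abs_of_pos (by positivity), ← ENNReal.ofReal_mul (by positivity)]
  congr 1
  rw [div_mul_eq_mul_div, one_mul, mul_one_div]

theorem lintegral_exp_neg_mul_norm_sq {b : ℝ} (hb : 0 < b) :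
    ∫⁻ y : EuclideanSpace ℝ (Fin 3), ENNReal.ofReal (exp (-b * ‖y‖ ^ 2))
      = ENNReal.ofReal ((π / b) ^ (3 / 2 : ℝ)) := by
  have h := GaussianFourier.integral_rexp_neg_mul_sq_norm (V := EuclideanSpace ℝ (Fin 3)) hb
  have hi : Integrable fun y : EuclideanSpace ℝ (Fin 3) => exp (-b * ‖y‖ ^ 2) :=
    Integrable.of_integral_ne_zero (by rw [h]; positivity)
  rw [← ofReal_integral_eq_lintegral_ofReal hi (ae_of_all _ fun t => (exp_pos _).le), h]
  simp

theorem lintegral_exp_neg_mul_norm_sq_div_norm_sq_le {c : ℝ} (hc : 0 < c) :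
    ∫⁻ u : EuclideanSpace ℝ (Fin 3), ENNReal.ofReal (exp (-c * ‖u‖ ^ 2) / ‖u‖ ^ 2)
      ≤ ENNReal.ofReal (2 * π ^ (3 / 2 : ℝ) / √c) := by
  calc _ ≤ ∫⁻ u : EuclideanSpace ℝ (Fin 3), ∫⁻ a in Set.Ioi c,
        ENNReal.ofReal (exp (-a * ‖u‖ ^ 2)) := by
        refine lintegral_mono fun u => ?_
        rcases eq_or_ne u 0 with rfl | hu
        · simp
        · have hu' : 0 < ‖u‖ ^ 2 := by positivity
          have h := (lintegral_exp_neg_mul_Ioi hu' c).symm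
          simp only [neg_mul, mul_comm (‖u‖ ^ 2)] at h ⊢
          exact h.le
    _ = ∫⁻ a in Set.Ioi c, ∫⁻ u : EuclideanSpace ℝ (Fin 3),
        ENNReal.ofReal (exp (-a * ‖u‖ ^ 2)) :=
        lintegral_lintegral_swap (by fun_prop)
    _ = ∫⁻ a in Set.Ioi c, ENNReal.ofReal (π ^ (3 / 2 : ℝ) * a ^ (-(3 / 2) : ℝ)) := by
        refine setLIntegral_congr_fun measurableSet_Ioi fun a ha => ?_
        have ha' : 0 < a := hc.trans ha
        rw [lintegral_exp_neg_mul_norm_sq ha', div_rpow pi_pos.le ha'.le, rpow_neg ha'.le,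
          div_eq_mul_inv]
    _ = _ := by
        rw [← ofReal_integral_eq_lintegral_ofReal
          ((integrableOn_Ioi_rpow_of_lt (by norm_num) hc).const_mul _), integral_const_mul,
          integral_Ioi_rpow_of_lt (by norm_num) hc]
        · congr 1
          rw [show (-(3 / 2) + 1 : ℝ) = -(1 / 2) by norm_num, rpow_neg hc.le, ← sqrt_eq_rpow]
          field_simp
        · filter_upwards [ae_restrict_mem measurableSet_Ioi] with a ha
          have ha' : 0 < a := hc.trans ha
          simp only [Pi.zero_apply]
          positivity

theorem lintegral_exp_neg_mul_norm_sq_conv {a b : ℝ} (ha : 0 < a) (hb : 0 < b)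
    (u : EuclideanSpace ℝ (Fin 3)) :
    ∫⁻ y : EuclideanSpace ℝ (Fin 3),
        ENNReal.ofReal (exp (-(a * ‖u + y‖ ^ 2)) * exp (-(b * ‖y‖ ^ 2)))
      = ENNReal.ofReal ((π / (a + b)) ^ (3 / 2 : ℝ) * exp (-(a * b / (a + b)) * ‖u‖ ^ 2)) := by
  have key : ∀ y : EuclideanSpace ℝ (Fin 3),
      a * ‖u + y‖ ^ 2 + b * ‖y‖ ^ 2
        = (a + b) * ‖y + (a / (a + b)) • u‖ ^ 2 + a * b / (a + b) * ‖u‖ ^ 2 := by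
    intro y
    rw [norm_add_sq_real, norm_add_sq_real, norm_smul, inner_smul_right, real_inner_comm,
      mul_pow, norm_eq_abs, sq_abs]
    field_simp
    ring
  calc _ = ∫⁻ y : EuclideanSpace ℝ (Fin 3),
        ENNReal.ofReal (exp (-(a + b) * ‖y + (a / (a + b)) • u‖ ^ 2))
          * ENNReal.ofReal (exp (-(a * b / (a + b)) * ‖u‖ ^ 2)) := by
        refine lintegral_congr fun y => ?_
        rw [← ENNReal.ofReal_mul (exp_pos _).le, ← exp_add, ← exp_add]
        congr 2
        linear_combination -key y
    _ = _ := by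
        rw [lintegral_mul_const' _ _ ENNReal.ofReal_ne_top,
          lintegral_add_right_eq_self (fun y : EuclideanSpace ℝ (Fin 3) =>
            ENNReal.ofReal (exp (-(a + b) * ‖y‖ ^ 2))),
          lintegral_exp_neg_mul_norm_sq (by positivity), ← ENNReal.ofReal_mul (by positivity)]

theorem lintegral_gaussian_mul_gaussian_div_dist_sq_le {a b : ℝ} (ha : 0 < a) (hb : 0 < b) :
    ∫⁻ p : EuclideanSpace ℝ (Fin 3) × EuclideanSpace ℝ (Fin 3),
        ENNReal.ofReal (exp (-(a * ‖p.1‖ ^ 2)) * exp (-(b * ‖p.2‖ ^ 2)) / ‖p.1 - p.2‖ ^ 2)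
      ≤ ENNReal.ofReal (2 * π ^ 3 / ((a + b) * √(a * b))) := by
  calc _ = ∫⁻ y : EuclideanSpace ℝ (Fin 3), ∫⁻ u : EuclideanSpace ℝ (Fin 3),
        ENNReal.ofReal (exp (-(a * ‖u + y‖ ^ 2)) * exp (-(b * ‖y‖ ^ 2)) / ‖u‖ ^ 2) := by
        rw [Measure.volume_eq_prod, lintegral_prod_symm _ (by fun_prop)]
        refine lintegral_congr fun y => ?_
        rw [← lintegral_add_right_eq_self _ y]
        simp
    _ = ∫⁻ u : EuclideanSpace ℝ (Fin 3), ∫⁻ y : EuclideanSpace ℝ (Fin 3),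
        ENNReal.ofReal (exp (-(a * ‖u + y‖ ^ 2)) * exp (-(b * ‖y‖ ^ 2)) / ‖u‖ ^ 2) :=
        lintegral_lintegral_swap (by fun_prop)
    _ = ∫⁻ u : EuclideanSpace ℝ (Fin 3), ENNReal.ofReal ((π / (a + b)) ^ (3 / 2 : ℝ)) *
          ENNReal.ofReal (exp (-(a * b / (a + b)) * ‖u‖ ^ 2) / ‖u‖ ^ 2) := by
        refine lintegral_congr fun u => ?_
        simp only [div_eq_mul_inv _ (‖u‖ ^ 2)]
        simp only [ENNReal.ofReal_mul' (inv_nonneg.mpr (sq_nonneg ‖u‖))]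
        rw [lintegral_mul_const' _ _ ENNReal.ofReal_ne_top,
          lintegral_exp_neg_mul_norm_sq_conv ha hb, ENNReal.ofReal_mul (by positivity), mul_assoc]
    _ ≤ ENNReal.ofReal ((π / (a + b)) ^ (3 / 2 : ℝ)) *
          ENNReal.ofReal (2 * π ^ (3 / 2 : ℝ) / √(a * b / (a + b))) := by
        rw [lintegral_const_mul' _ _ ENNReal.ofReal_ne_top]
        gcongr
        exact lintegral_exp_neg_mul_norm_sq_div_norm_sq_le (by positivity)
    _ = _ := by
        rw [← ENNReal.ofReal_mul (by positivity)]
        congr 1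
        have h3 : ∀ x : ℝ, 0 < x → x ^ (3 / 2 : ℝ) = x * √x := fun x hx => by
          rw [show (3 / 2 : ℝ) = 1 + 1 / 2 by norm_num, rpow_add hx, rpow_one, sqrt_eq_rpow]
        rw [h3 _ (by positivity), h3 _ pi_pos, sqrt_div pi_pos.le, sqrt_div (by positivity)]
        have hs : √π ^ 2 = π := sq_sqrt pi_pos.le
        field_simp
        rw [hs]

theorem ofReal_yukawa_le (x : EuclideanSpace ℝ (Fin 3)) :
    ENNReal.ofReal (exp (-‖x‖) / ‖x‖) ≤ ENNReal.ofReal (2 / √π) *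
      ∫⁻ v in Set.Ioi (0 : ℝ),
        ENNReal.ofReal (exp (-(v ^ 2 * ‖x‖ ^ 2)) * exp (-1 / (4 * v ^ 2))) := by
  rcases eq_or_ne x 0 with rfl | hx
  · simp
  · rw [lintegral_exp_neg_sq_sub_inv_sq (norm_pos_iff.mpr hx),
      ← ENNReal.ofReal_mul (by positivity)]
    refine le_of_eq (congrArg _ ?_)
    field_simp

theorem lintegral_exp_neg_inv_sq_div_eq_one :
    ∫⁻ q : ℝ × ℝ, ENNReal.ofReal (exp (-1 / (4 * q.1 ^ 2)) * exp (-1 / (4 * q.2 ^ 2)) /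
        ((q.1 ^ 2 + q.2 ^ 2) * (q.1 * q.2)))
        ∂((volume.restrict (Set.Ioi 0)).prod (volume.restrict (Set.Ioi 0))) = 1 := by
  set B : ℝ → ℝ → ENNReal := fun a v =>
    ENNReal.ofReal (exp (-a / (4 * v ^ 2)) / (2 * v ^ 3)) with hB
  calc _ = ∫⁻ q : ℝ × ℝ, (∫⁻ a in Set.Ioi (1 : ℝ), B a q.1 * B a q.2)
        ∂((volume.restrict (Set.Ioi 0)).prod (volume.restrict (Set.Ioi 0))) := by
        refine lintegral_congr_ae ?_
        rw [Measure.prod_restrict]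
        filter_upwards [ae_restrict_mem (measurableSet_Ioi.prod measurableSet_Ioi)] with q hq
        obtain ⟨v, w⟩ := q
        have hv : 0 < v := hq.1
        have hw : 0 < w := hq.2
        set S := 1 / (4 * v ^ 2) + 1 / (4 * w ^ 2) with hS
        have hS0 : 0 < S := by positivity
        have h : ∀ a, B a v * B a w = ENNReal.ofReal (exp (-S * a)) *
            ENNReal.ofReal (1 / (2 * v ^ 3) * (1 / (2 * w ^ 3))) := fun a => by
          simp only [hB]
          rw [← ENNReal.ofReal_mul (by positivity), ← ENNReal.ofReal_mul (by positivity),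
            show -S * a = -a / (4 * v ^ 2) + -a / (4 * w ^ 2) by simp only [hS]; ring, exp_add]
          congr 1
          ring
        simp only [h]
        rw [lintegral_mul_const' _ _ ENNReal.ofReal_ne_top, lintegral_exp_neg_mul_Ioi hS0,
          ← ENNReal.ofReal_mul (by positivity), ← exp_add,
          show -S * 1 = -1 / (4 * v ^ 2) + -1 / (4 * w ^ 2) by simp only [hS]; ring]
        congr 1
        simp only [hS]
        field_simp
        ring
    _ = ∫⁻ a in Set.Ioi (1 : ℝ), ∫⁻ q : ℝ × ℝ, B a q.1 * B a q.2
        ∂((volume.restrict (Set.Ioi 0)).prod (volume.restrict (Set.Ioi 0))) :=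
        lintegral_lintegral_swap (by simp only [hB]; fun_prop)
    _ = ∫⁻ a in Set.Ioi (1 : ℝ), ENNReal.ofReal (a ^ (-2 : ℝ)) := by
        refine setLIntegral_congr_fun measurableSet_Ioi fun a ha => ?_
        have ha' : 0 < a := one_pos.trans ha
        rw [lintegral_prod_mul (by simp only [hB]; fun_prop) (by simp only [hB]; fun_prop)]
        simp only [hB]
        rw [lintegral_exp_neg_inv_sq_div_cube ha', ← ENNReal.ofReal_mul (by positivity),
          rpow_neg ha'.le, rpow_two]
        congr 1
        field_simp
    _ = 1 := by
        rw [← ofReal_integral_eq_lintegral_ofReal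
          (integrableOn_Ioi_rpow_of_lt (by norm_num) one_pos),
          integral_Ioi_rpow_of_lt (by norm_num) one_pos]
        · norm_num
        · filter_upwards [ae_restrict_mem measurableSet_Ioi] with a ha
          have ha' : (0:ℝ) < a := one_pos.trans ha
          simp only [Pi.zero_apply]
          positivity

theorem lintegral_yukawa_rollnik_le :
    ∫⁻ p : EuclideanSpace ℝ (Fin 3) × EuclideanSpace ℝ (Fin 3),
        ENNReal.ofReal (exp (-‖p.1‖) * exp (-‖p.2‖) / (‖p.1‖ * ‖p.2‖ * ‖p.1 - p.2‖ ^ 2))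
      ≤ ENNReal.ofReal (8 * π ^ 2) := by
  set μ : Measure ℝ := volume.restrict (Set.Ioi 0) with hμ
  set A : ℝ → EuclideanSpace ℝ (Fin 3) → ENNReal := fun v x =>
    ENNReal.ofReal (exp (-(v ^ 2 * ‖x‖ ^ 2)) * exp (-1 / (4 * v ^ 2))) with hA
  calc _ ≤ ∫⁻ p : EuclideanSpace ℝ (Fin 3) × EuclideanSpace ℝ (Fin 3),
        ENNReal.ofReal (4 / π) * ∫⁻ q : ℝ × ℝ,
          A q.1 p.1 * A q.2 p.2 * ENNReal.ofReal (1 / ‖p.1 - p.2‖ ^ 2) ∂(μ.prod μ) := by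
        refine lintegral_mono fun p => ?_
        rw [lintegral_mul_const' _ _ ENNReal.ofReal_ne_top,
          lintegral_prod_mul (f := fun v => A v p.1) (g := fun w => A w p.2)
            (by simp only [hA]; fun_prop) (by simp only [hA]; fun_prop),
          show exp (-‖p.1‖) * exp (-‖p.2‖) / (‖p.1‖ * ‖p.2‖ * ‖p.1 - p.2‖ ^ 2)
            = exp (-‖p.1‖) / ‖p.1‖ * (exp (-‖p.2‖) / ‖p.2‖) * (1 / ‖p.1 - p.2‖ ^ 2) by
              simp only [div_eq_mul_inv, mul_inv]; ring,
          ENNReal.ofReal_mul (by positivity), ENNReal.ofReal_mul (by positivity)]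
        have hc : ENNReal.ofReal (4 / π)
            = ENNReal.ofReal (2 / √π) * ENNReal.ofReal (2 / √π) := by
          rw [← ENNReal.ofReal_mul (by positivity), div_mul_div_comm, mul_self_sqrt pi_pos.le]
          norm_num
        refine (mul_le_mul' (mul_le_mul' (ofReal_yukawa_le p.1) (ofReal_yukawa_le p.2))
          le_rfl).trans_eq ?_
        rw [hc]
        ring
    _ = ENNReal.ofReal (4 / π) * ∫⁻ q : ℝ × ℝ,
          (∫⁻ p : EuclideanSpace ℝ (Fin 3) × EuclideanSpace ℝ (Fin 3),
          A q.1 p.1 * A q.2 p.2 * ENNReal.ofReal (1 / ‖p.1 - p.2‖ ^ 2)) ∂(μ.prod μ) := by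
        rw [lintegral_const_mul' _ _ ENNReal.ofReal_ne_top,
          lintegral_lintegral_swap (by simp only [hA]; fun_prop)]
    _ ≤ ENNReal.ofReal (4 / π) * ∫⁻ q : ℝ × ℝ, ENNReal.ofReal (2 * π ^ 3) *
          ENNReal.ofReal (exp (-1 / (4 * q.1 ^ 2)) * exp (-1 / (4 * q.2 ^ 2)) /
          ((q.1 ^ 2 + q.2 ^ 2) * (q.1 * q.2))) ∂(μ.prod μ) := by
        refine mul_le_mul' le_rfl (lintegral_mono_ae ?_)
        rw [hμ, Measure.prod_restrict]
        filter_upwards [ae_restrict_mem (measurableSet_Ioi.prod measurableSet_Ioi)] with q hq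
        obtain ⟨v, w⟩ := q
        have hv : 0 < v := hq.1
        have hw : 0 < w := hq.2
        have h : ∀ p : EuclideanSpace ℝ (Fin 3) × EuclideanSpace ℝ (Fin 3),
            A v p.1 * A w p.2 * ENNReal.ofReal (1 / ‖p.1 - p.2‖ ^ 2)
              = ENNReal.ofReal (exp (-1 / (4 * v ^ 2)) * exp (-1 / (4 * w ^ 2))) *
                ENNReal.ofReal (exp (-(v ^ 2 * ‖p.1‖ ^ 2)) * exp (-(w ^ 2 * ‖p.2‖ ^ 2)) /
                  ‖p.1 - p.2‖ ^ 2) := fun p => by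
          simp only [hA]
          rw [← ENNReal.ofReal_mul (by positivity), ← ENNReal.ofReal_mul (by positivity),
            ← ENNReal.ofReal_mul (by positivity)]
          congr 1
          ring
        simp only [h]
        rw [lintegral_const_mul' _ _ ENNReal.ofReal_ne_top]
        refine (mul_le_mul' le_rfl (lintegral_gaussian_mul_gaussian_div_dist_sq_le
          (pow_pos hv 2) (pow_pos hw 2))).trans_eq ?_
        rw [← ENNReal.ofReal_mul (by positivity), ← ENNReal.ofReal_mul (by positivity),
          ← mul_pow, sqrt_sq (by positivity)]
        congr 1
        ring
    _ = _ := by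
        rw [lintegral_const_mul' _ _ ENNReal.ofReal_ne_top, lintegral_exp_neg_inv_sq_div_eq_one,
          mul_one, ← ENNReal.ofReal_mul (by positivity)]
        congr 1
        field_simp
        norm_num

theorem yukawa_rollnik_bound :
    (∫ p : EuclideanSpace ℝ (Fin 3) × EuclideanSpace ℝ (Fin 3),
        Real.exp (-‖p.1‖) * Real.exp (-‖p.2‖) / (‖p.1‖ * ‖p.2‖ * ‖p.1 - p.2‖ ^ 2))
      ≤ 16 * Real.pi ^ ((10 : ℝ) / 3) / 9 ∧
    16 * Real.pi ^ ((10 : ℝ) / 3) / 9 < 16 * Real.pi ^ 2 := by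
  have hsplit : π ^ ((10 : ℝ) / 3) = π ^ 2 * π ^ ((4 : ℝ) / 3) := by
    rw [← rpow_two, ← rpow_add pi_pos]
    norm_num
  have hcube : (π ^ ((4 : ℝ) / 3)) ^ 3 = π ^ 4 := by
    rw [← rpow_natCast, ← rpow_mul pi_pos.le, ← rpow_natCast]
    norm_num
  have hlower : 9 / 2 ≤ π ^ ((4 : ℝ) / 3) := by
    refine le_of_pow_le_pow_left₀ three_ne_zero (by positivity) ?_
    rw [hcube]
    calc (9 / 2 : ℝ) ^ 3 ≤ 3.14 ^ 4 := by norm_num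
      _ ≤ π ^ 4 := by gcongr; exact pi_gt_d2.le
  have hupper : π ^ ((4 : ℝ) / 3) < 9 := by
    refine lt_of_pow_lt_pow_left₀ 3 (by norm_num) ?_
    rw [hcube]
    calc π ^ 4 ≤ 4 ^ 4 := by gcongr; exact pi_le_four
      _ < 9 ^ 3 := by norm_num
  have hpi : 0 < π ^ 2 := by positivity
  rw [hsplit]
  refine ⟨?_, by nlinarith⟩
  rw [integral_eq_lintegral_of_nonneg_ae (ae_of_all _ fun p => by
      simp only [Pi.zero_apply]; positivity)
    (Measurable.aestronglyMeasurable (by fun_prop))]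
  refine (ENNReal.toReal_le_of_le_ofReal (by positivity) lintegral_yukawa_rollnik_le).trans ?_
  nlinarith
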